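/- arXiv:2404.01544 — 2 statements merged into one kernel-verified Lean document; each statement's English description precedes it below -/
import Mathlib

section
/- Let n ≥ 1 be an integer and let a, b be real numbers with b > 0 and n + 2a > 0. Then there exists a constant C > 0 such that for all t ≥ 0, ( ∫_{ξ ∈ ℝⁿ, |ξ| < 1} |ξ|^{2a} e^{−2t|ξ|^{b}} dξ )^{1/2} ≤ C (1 + t)^{−(n+2a)/(2b)}; that is, the L²-norm of ξ ↦ |ξ|^{a} e^{−t|ξ|^{b}} over the unit ball satisfies ‖ |ξ|^{a} e^{−t|ξ|^{b}} ‖_{L²(|ξ|<1)} ≤ C (1 + t)^{−(n+2a)/(2b)}. -/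
open MeasureTheory

/-- Radial weights `‖ξ‖ ^ s * exp (-c ‖ξ‖ ^ b)` are integrable as soon as `s` exceeds minus the
dimension. -/
lemma integrable_norm_rpow_mul_exp_neg_mul_norm_rpow {n : ℕ} (hn : 1 ≤ n) {s b c : ℝ}
    (hb : 0 < b) (hc : 0 < c) (hs : 0 < (n : ℝ) + s) :
    Integrable fun ξ : EuclideanSpace ℝ (Fin n) ↦ ‖ξ‖ ^ s * Real.exp (-c * ‖ξ‖ ^ b) := by
  have : Nontrivial (EuclideanSpace ℝ (Fin n)) :=
    Module.nontrivial_of_finrank_pos (R := ℝ) (by simpa using Nat.lt_of_succ_le hn)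
  rw [integrable_fun_norm_addHaar volume (f := fun y : ℝ ↦ y ^ s * Real.exp (-c * y ^ b))]
  refine (integrableOn_rpow_mul_exp_neg_mul_rpow (s := (n : ℝ) - 1 + s) (by linarith) hb
    hc).congr_fun (fun y hy ↦ ?_) measurableSet_Ioi
  simp only [finrank_euclideanSpace, Fintype.card_fin, smul_eq_mul]
  rw [Real.rpow_add hy, ← Nat.cast_pred hn, Real.rpow_natCast, mul_assoc]

/-- Scaling of the radial integral of `‖ξ‖ ^ s * exp (-c ‖ξ‖ ^ b)` in the parameter `c`. -/
lemma integral_norm_rpow_mul_exp_neg_mul_norm_rpow {n : ℕ} (hn : 1 ≤ n) {s b c : ℝ}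
    (hb : 0 < b) (hc : 0 < c) (hs : 0 < (n : ℝ) + s) :
    ∫ ξ : EuclideanSpace ℝ (Fin n), ‖ξ‖ ^ s * Real.exp (-c * ‖ξ‖ ^ b) =
      n * volume.real (Metric.ball (0 : EuclideanSpace ℝ (Fin n)) 1) *
        (c ^ (-((n + s) / b)) * (1 / b) * Real.Gamma ((n + s) / b)) := by
  have : Nontrivial (EuclideanSpace ℝ (Fin n)) :=
    Module.nontrivial_of_finrank_pos (R := ℝ) (by simpa using Nat.lt_of_succ_le hn)
  have key := integral_rpow_mul_exp_neg_mul_rpow (q := (n : ℝ) - 1 + s) hb (by linarith) hc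
  rw [show (n : ℝ) - 1 + s + 1 = n + s by ring] at key
  rw [integral_fun_norm_addHaar volume (fun y : ℝ ↦ y ^ s * Real.exp (-c * y ^ b)), ← neg_div,
    ← key, nsmul_eq_mul, smul_eq_mul, finrank_euclideanSpace, Fintype.card_fin, ← mul_assoc]
  congr 1
  refine setIntegral_congr_fun measurableSet_Ioi fun y hy ↦ ?_
  simp only [smul_eq_mul]
  rw [Real.rpow_add hy, ← Nat.cast_pred hn, Real.rpow_natCast, mul_assoc]

theorem low_frequency_L2_decay (n : ℕ) (hn : 1 ≤ n) (a b : ℝ) (hb : 0 < b)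
    (hna : 0 < (n : ℝ) + 2 * a) :
    ∃ C > 0, ∀ t : ℝ, 0 ≤ t →
      (∫ ξ in Metric.ball (0 : EuclideanSpace ℝ (Fin n)) 1,
          ‖ξ‖ ^ (2 * a) * Real.exp (-(2 * t * ‖ξ‖ ^ b))) ^ ((1:ℝ)/2)
        ≤ C * (1 + t) ^ (-(((n : ℝ) + 2 * a) / (2 * b))) := by
  set K : ℝ := Real.exp 2 * (n * volume.real (Metric.ball (0 : EuclideanSpace ℝ (Fin n)) 1) *
    (2 ^ (-((n + 2 * a) / b)) * (1 / b) * Real.Gamma ((n + 2 * a) / b))) with hK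
  have hK0 : 0 < K := by
    have hn' : (0 : ℝ) < n := by exact_mod_cast hn
    have hv : 0 < volume.real (Metric.ball (0 : EuclideanSpace ℝ (Fin n)) 1) :=
      ENNReal.toReal_pos (Metric.measure_ball_pos _ _ one_pos).ne' measure_ball_lt_top.ne
    have hG : 0 < Real.Gamma ((n + 2 * a) / b) := Real.Gamma_pos_of_pos (by positivity)
    positivity
  refine ⟨K ^ ((1 : ℝ) / 2), by positivity, fun t ht ↦ ?_⟩
  have ht' : 0 < 1 + t := by linarith
  have hint := (integrable_norm_rpow_mul_exp_neg_mul_norm_rpow hn hb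
    (mul_pos two_pos ht') hna).const_mul (Real.exp 2)
  have hbound : ∫ ξ in Metric.ball (0 : EuclideanSpace ℝ (Fin n)) 1,
      ‖ξ‖ ^ (2 * a) * Real.exp (-(2 * t * ‖ξ‖ ^ b)) ≤ K * (1 + t) ^ (-((n + 2 * a) / b)) :=
    calc
      _ ≤ ∫ ξ in Metric.ball (0 : EuclideanSpace ℝ (Fin n)) 1,
          Real.exp 2 * (‖ξ‖ ^ (2 * a) * Real.exp (-(2 * (1 + t)) * ‖ξ‖ ^ b)) := by
        refine integral_mono_of_nonneg (ae_of_all _ fun ξ ↦ by positivity) hint.integrableOn ?_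
        filter_upwards [ae_restrict_mem measurableSet_ball] with ξ hξ
        have hξ1 : ‖ξ‖ ^ b ≤ 1 :=
          Real.rpow_le_one (norm_nonneg _) (mem_ball_zero_iff.1 hξ).le hb.le
        rw [mul_left_comm, ← Real.exp_add]
        gcongr
        linarith
      _ ≤ ∫ ξ : EuclideanSpace ℝ (Fin n),
          Real.exp 2 * (‖ξ‖ ^ (2 * a) * Real.exp (-(2 * (1 + t)) * ‖ξ‖ ^ b)) :=
        setIntegral_le_integral hint (ae_of_all _ fun ξ ↦ by positivity)
      _ = K * (1 + t) ^ (-((n + 2 * a) / b)) := by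
        rw [integral_const_mul, integral_norm_rpow_mul_exp_neg_mul_norm_rpow hn hb
          (mul_pos two_pos ht') hna, Real.mul_rpow two_pos.le ht'.le, hK]
        ring
  calc
    _ ≤ (K * (1 + t) ^ (-((n + 2 * a) / b))) ^ ((1 : ℝ) / 2) :=
      Real.rpow_le_rpow (integral_nonneg fun ξ ↦ by positivity) hbound (by norm_num)
    _ = _ := by
      rw [Real.mul_rpow hK0.le (by positivity), ← Real.rpow_mul ht'.le]
      congr 2
      field_simp
end

section
/- Let n ≥ 1 be an integer, s > 0 a real number, and q a real number with 2 ≤ q < ∞ and θ_q := (n/s)(1/2 − 1/q) ∈ [0, 1]. Then there exists a constant C > 0 such that for every Schwartz function g : ℝⁿ → ℂ, ‖g‖_{L^q(ℝⁿ)} ≤ C · ( ∫_{ℝⁿ} | |ξ|^{s} (𝓕g)(ξ) |² dξ )^{θ_q/2} · ‖g‖_{L²(ℝⁿ)}^{1 − θ_q}. -/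
open MeasureTheory
open scoped FourierTransform

section

variable {V : Type*} [NormedAddCommGroup V] [InnerProductSpace ℝ V] [FiniteDimensional ℝ V]
  [MeasurableSpace V] [BorelSpace V]

/-- The integral of a negative power of the norm over a ball centred at the origin. -/
theorem exists_lintegral_ball_norm_rpow_neg [Nontrivial V] {a : ℝ}
    (ha : a < Module.finrank ℝ V) :
    ∃ c > 0, ∀ R > 0, ∫⁻ ξ in Metric.ball (0 : V) R, ENNReal.ofReal (‖ξ‖ ^ (-a))
      = ENNReal.ofReal (c * R ^ ((Module.finrank ℝ V : ℝ) - a)) := by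
  set d := Module.finrank ℝ V with hd
  have hd0 : 0 < d := Module.finrank_pos
  have hpow : ∀ y : ℝ, 0 < y → y ^ (d - 1) • y ^ (-a) = y ^ ((d : ℝ) - 1 - a) := by
    intro y hy
    rw [smul_eq_mul, ← Real.rpow_natCast, ← Real.rpow_add hy, Nat.cast_sub hd0]
    simp [sub_eq_add_neg]
  have hb : 0 < volume.real (Metric.ball (0 : V) 1) :=
    ENNReal.toReal_pos (Metric.measure_ball_pos _ _ one_pos).ne' measure_ball_lt_top.ne
  have hda : 0 < (d : ℝ) - a := by linarith
  refine ⟨d * (volume.real (Metric.ball (0 : V) 1) * (1 / ((d : ℝ) - a))), by positivity,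
    fun R hR ↦ ?_⟩
  have hint : IntegrableOn (fun ξ : V ↦ ‖ξ‖ ^ (-a)) (Metric.ball 0 R) := by
    rw [integrableOn_fun_norm_addHaar volume (f := fun y : ℝ ↦ y ^ (-a)),
      integrableOn_congr_fun (fun y hy ↦ hpow y hy.1) measurableSet_Ioo,
      ← intervalIntegrable_iff_integrableOn_Ioo_of_le hR.le]
    exact intervalIntegral.intervalIntegrable_rpow' (by linarith)
  rw [← ofReal_integral_eq_lintegral_ofReal hint (ae_of_all _ fun ξ ↦ by positivity)]
  congr 1
  have h1 : ∫ ξ in Metric.ball (0 : V) R, ‖ξ‖ ^ (-a)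
      = ∫ ξ : V, (Set.Iio R).indicator (fun y : ℝ ↦ y ^ (-a)) ‖ξ‖ := by
    rw [← integral_indicator measurableSet_ball]
    congr with ξ
    simp [Set.indicator]
  rw [h1, integral_fun_norm_addHaar volume, nsmul_eq_mul, smul_eq_mul]
  have h2 : ∫ y in Set.Ioi (0 : ℝ), y ^ (d - 1) • (Set.Iio R).indicator (fun y : ℝ ↦ y ^ (-a)) y
      = ∫ y in (0 : ℝ)..R, y ^ ((d : ℝ) - 1 - a) := by
    rw [intervalIntegral.integral_of_le hR.le, integral_Ioc_eq_integral_Ioo,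
      ← Set.Ioi_inter_Iio, ← setIntegral_indicator measurableSet_Iio]
    refine setIntegral_congr_fun measurableSet_Ioi fun y hy ↦ ?_
    by_cases hyR : y < R
    · simp only [Set.indicator, Set.mem_Iio, hyR, if_true]
      exact hpow y hy
    · simp [Set.indicator, hyR]
  rw [← hd, h2, integral_rpow (Or.inl (by linarith))]
  rw [show (d : ℝ) - 1 - a + 1 = d - a by ring, Real.zero_rpow hda.ne']
  ring

/-- The low-frequency part of a function is controlled by its homogeneous Sobolev norm. -/
theorem lintegral_ball_enorm_le [Nontrivial V] {σ : ℝ} {h : V → ℂ} (hh : Measurable h) (R : ℝ) :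
    ∫⁻ ξ in Metric.ball (0 : V) R, ‖h ξ‖ₑ
      ≤ (∫⁻ ξ in Metric.ball (0 : V) R, ENNReal.ofReal (‖ξ‖ ^ (-(2 * σ)))) ^ (1 / 2 : ℝ)
        * (∫⁻ ξ, ENNReal.ofReal ((‖ξ‖ ^ σ * ‖h ξ‖) ^ 2)) ^ (1 / 2 : ℝ) := by
  calc ∫⁻ ξ in Metric.ball (0 : V) R, ‖h ξ‖ₑ
      = ∫⁻ ξ in Metric.ball (0 : V) R, ENNReal.ofReal (‖ξ‖ ^ (-(2 * σ))) ^ (1 / 2 : ℝ)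
          * ENNReal.ofReal ((‖ξ‖ ^ σ * ‖h ξ‖) ^ 2) ^ (1 / 2 : ℝ) := by
        refine lintegral_congr_ae (ae_restrict_of_ae ?_)
        filter_upwards [compl_mem_ae_iff.2 (measure_singleton (0 : V))] with ξ hξ
        have hξ : 0 < ‖ξ‖ := norm_pos_iff.2 hξ
        rw [ENNReal.ofReal_rpow_of_nonneg (by positivity) (by norm_num),
          ENNReal.ofReal_rpow_of_nonneg (by positivity) (by norm_num),
          ← ENNReal.ofReal_mul (by positivity), ← ofReal_norm, ← Real.rpow_mul hξ.le,
          ← Real.sqrt_eq_rpow, Real.sqrt_sq (by positivity), ← mul_assoc, ← Real.rpow_add hξ]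
        ring_nf
        simp
    _ ≤ (∫⁻ ξ in Metric.ball (0 : V) R, ENNReal.ofReal (‖ξ‖ ^ (-(2 * σ)))) ^ (1 / 2 : ℝ)
        * (∫⁻ ξ in Metric.ball (0 : V) R,
            ENNReal.ofReal ((‖ξ‖ ^ σ * ‖h ξ‖) ^ 2)) ^ (1 / 2 : ℝ) :=
        ENNReal.lintegral_mul_norm_pow_le (by fun_prop) (by fun_prop) (by norm_num) (by norm_num)
          (by norm_num)
    _ ≤ _ := by
        gcongr
        exact Measure.restrict_le_self

theorem lintegral_sq_fourier (f : SchwartzMap V ℂ) :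
    ∫⁻ ξ, ‖𝓕 f ξ‖ₑ ^ 2 = ∫⁻ x, ‖f x‖ₑ ^ 2 := by
  have key : ∀ u : SchwartzMap V ℂ, ∫⁻ x, ‖u x‖ₑ ^ 2 = ENNReal.ofReal (∫ x, ‖u x‖ ^ 2) := by
    intro u
    rw [ofReal_integral_eq_lintegral_ofReal _ (ae_of_all _ fun x ↦ by positivity)]
    · refine lintegral_congr fun x ↦ ?_
      rw [← ofReal_norm, ENNReal.ofReal_pow (norm_nonneg _)]
    · exact (u.memLp 2).integrable_norm_pow (by norm_num)
  rw [key, key, SchwartzMap.integral_norm_sq_fourier]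

theorem enorm_fourierInv_le_lintegral (f : SchwartzMap V ℂ) (x : V) :
    ‖(𝓕⁻ f) x‖ₑ ≤ ∫⁻ ξ, ‖f ξ‖ₑ := by
  rw [SchwartzMap.fourierInv_coe, Real.fourierInv_eq]
  refine (enorm_integral_le_lintegral_enorm _).trans_eq (lintegral_congr fun v ↦ ?_)
  rw [← ofReal_norm, ← ofReal_norm, Circle.norm_smul]

/-- Decomposition of a Schwartz function into its low and high frequencies. -/
theorem exists_frequency_decomposition (g : SchwartzMap V ℂ) {A : ℝ} (hA : 0 < A) :
    ∃ u v : SchwartzMap V ℂ, (∀ x, g x = u x + v x) ∧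
      (∀ x, ‖u x‖ₑ ≤ ∫⁻ ξ in Metric.ball (0 : V) (2 * A), ‖𝓕 g ξ‖ₑ) ∧
      ∫⁻ x, ‖v x‖ₑ ^ 2 ≤ ∫⁻ ξ in {ξ : V | A ≤ ‖ξ‖}, ‖𝓕 g ξ‖ₑ ^ 2 := by
  let χ : ContDiffBump (0 : V) := ⟨A, 2 * A, hA, by linarith⟩
  have hχ : Function.HasTemperateGrowth (fun ξ ↦ (χ ξ : ℝ)) :=
    χ.hasCompactSupport.hasTemperateGrowth χ.contDiff
  let w : SchwartzMap V ℂ := SchwartzMap.smulLeftCLM ℂ (fun ξ ↦ χ ξ) (𝓕 g)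
  have hw : ∀ ξ, w ξ = (χ ξ : ℂ) * 𝓕 g ξ := fun ξ ↦ by
    simp [w, SchwartzMap.smulLeftCLM_apply_apply hχ]
  refine ⟨𝓕⁻ w, g - 𝓕⁻ w, fun x ↦ by simp, fun x ↦ ?_, ?_⟩
  · refine (enorm_fourierInv_le_lintegral w x).trans ?_
    rw [← lintegral_indicator measurableSet_ball]
    refine lintegral_mono fun ξ ↦ ?_
    by_cases hξ : ξ ∈ Metric.ball (0 : V) (2 * A)
    · rw [Set.indicator_of_mem hξ, hw, enorm_mul]
      refine mul_le_of_le_one_left' ?_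
      rw [← ofReal_norm, Complex.norm_real, Real.norm_of_nonneg χ.nonneg]
      exact ENNReal.ofReal_le_one.2 χ.le_one
    · have : χ ξ = 0 := χ.zero_of_le_dist (by simpa [χ] using hξ)
      simp [hw, this]
  · have hS : MeasurableSet {ξ : V | A ≤ ‖ξ‖} := measurableSet_le measurable_const measurable_norm
    rw [← lintegral_sq_fourier, ← lintegral_indicator hS]
    refine lintegral_mono fun ξ ↦ ?_
    have hv : 𝓕 (g - 𝓕⁻ w) ξ = ((1 - χ ξ : ℝ) : ℂ) * 𝓕 g ξ := by
      rw [sub_eq_add_neg, FourierAdd.fourier_add, FourierTransform.fourier_neg,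
        FourierTransform.fourier_fourierInv_eq, ← sub_eq_add_neg, sub_apply, hw]
      push_cast
      ring
    by_cases hξ : ξ ∈ {ξ : V | A ≤ ‖ξ‖}
    · rw [Set.indicator_of_mem hξ, hv, enorm_mul]
      gcongr
      refine mul_le_of_le_one_left' ?_
      rw [← ofReal_norm, Complex.norm_real, Real.norm_of_nonneg (sub_nonneg.2 χ.le_one)]
      exact ENNReal.ofReal_le_one.2 (by linarith [χ.nonneg (x := ξ)])
    · have : χ ξ = 1 := χ.one_of_mem_closedBall (by simpa [χ] using (not_le.1 hξ).le)
      simp [hv, this]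

theorem exists_meas_norm_gt_le [Nontrivial V] {σ β : ℝ} (hβ : 0 < β)
    (hσβ : (Module.finrank ℝ V : ℝ) - 2 * σ = 2 * β) :
    ∃ k > 0, ∀ (g : SchwartzMap V ℂ) (M t : ℝ), 0 < M → 0 < t →
      ∫⁻ ξ, ENNReal.ofReal ((‖ξ‖ ^ σ * ‖𝓕 g ξ‖) ^ 2) ≤ ENNReal.ofReal (M ^ 2) →
      volume {x | t < ‖g x‖}
        ≤ ENNReal.ofReal (4 / t ^ 2) * ∫⁻ ξ in {ξ : V | t ≤ k * M * ‖ξ‖ ^ β}, ‖𝓕 g ξ‖ₑ ^ 2 := by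
  obtain ⟨c, hc, hball⟩ := exists_lintegral_ball_norm_rpow_neg (V := V) (a := 2 * σ) (by linarith)
  refine ⟨2 * (√c * 2 ^ β), by positivity, fun g M t hM ht hg ↦ ?_⟩
  set k := √c * 2 ^ β with hk
  have hk0 : 0 < k := by positivity
  set A := (t / (2 * k * M)) ^ (1 / β) with hA
  have hA0 : 0 < A := by positivity
  have hAβ : A ^ β = t / (2 * k * M) := by
    rw [hA, ← Real.rpow_mul (by positivity), one_div_mul_cancel hβ.ne', Real.rpow_one]
  obtain ⟨u, v, huv, hu, hv⟩ := exists_frequency_decomposition g hA0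
  have hu' : ∀ x, ‖u x‖ ≤ t / 2 := by
    intro x
    have h1 := (hu x).trans (lintegral_ball_enorm_le (σ := σ) (h := ⇑(𝓕 g : SchwartzMap V ℂ))
      (𝓕 g : SchwartzMap V ℂ).continuous.measurable (2 * A))
    rw [hball _ (by positivity), hσβ] at h1
    have h2 : ENNReal.ofReal (c * (2 * A) ^ (2 * β)) ^ (1 / 2 : ℝ)
        * ENNReal.ofReal (M ^ 2) ^ (1 / 2 : ℝ) = ENNReal.ofReal (t / 2) := by
      rw [ENNReal.ofReal_rpow_of_nonneg (by positivity) (by norm_num),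
        ENNReal.ofReal_rpow_of_nonneg (by positivity) (by norm_num),
        ← ENNReal.ofReal_mul (by positivity), ← Real.sqrt_eq_rpow, ← Real.sqrt_eq_rpow,
        Real.sqrt_sq hM.le, Real.sqrt_mul hc.le, mul_comm 2 β, Real.rpow_mul (by positivity),
        Real.rpow_two, Real.sqrt_sq (by positivity), Real.mul_rpow (by norm_num) hA0.le, hAβ,
        ← mul_assoc (√c), ← hk]
      congr 1
      field_simp
    have h3 : ‖u x‖ₑ ≤ ENNReal.ofReal (t / 2) := by
      refine h1.trans (le_trans ?_ h2.le)
      gcongr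
    rw [← ofReal_norm] at h3
    exact (ENNReal.ofReal_le_ofReal_iff (by positivity)).1 h3
  have hsub : {x | t < ‖g x‖} ⊆ {x | ENNReal.ofReal ((t / 2) ^ 2) ≤ ‖v x‖ₑ ^ 2} := by
    intro x (hx : t < ‖g x‖)
    have h1 : ‖g x‖ ≤ ‖u x‖ + ‖v x‖ := huv x ▸ norm_add_le _ _
    have h2 : t / 2 ≤ ‖v x‖ := by linarith [hu' x]
    rw [Set.mem_ofPred_eq, ← ofReal_norm, ← ENNReal.ofReal_pow (norm_nonneg _)]
    gcongr
  have hset : {ξ : V | A ≤ ‖ξ‖} = {ξ : V | t ≤ 2 * k * M * ‖ξ‖ ^ β} := by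
    ext ξ
    rw [Set.mem_ofPred_eq, Set.mem_ofPred_eq, ← Real.rpow_le_rpow_iff hA0.le (norm_nonneg ξ) hβ, hAβ,
      div_le_iff₀' (by positivity)]
  have hcheb := mul_meas_ge_le_lintegral (μ := volume) (f := fun x ↦ ‖v x‖ₑ ^ 2)
    (by have := v.continuous.measurable; fun_prop) (ENNReal.ofReal ((t / 2) ^ 2))
  rw [← hset]
  calc volume {x | t < ‖g x‖}
      = ENNReal.ofReal (4 / t ^ 2) * (ENNReal.ofReal ((t / 2) ^ 2) * volume {x | t < ‖g x‖}) := by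
        rw [← mul_assoc, ← ENNReal.ofReal_mul (by positivity),
          show 4 / t ^ 2 * (t / 2) ^ 2 = 1 by field_simp; norm_num, ENNReal.ofReal_one, one_mul]
    _ ≤ _ := by
        gcongr
        exact (mul_le_mul_right (measure_mono hsub) _).trans (hcheb.trans hv)

/-- The homogeneous Sobolev embedding, by real interpolation of frequency-localized bounds. -/
theorem exists_lintegral_norm_rpow_le [Nontrivial V] {σ β q : ℝ} (hβ : 0 < β) (hq : 2 < q)
    (hσβ : (Module.finrank ℝ V : ℝ) - 2 * σ = 2 * β) (hqβ : β * (q - 2) = 2 * σ) :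
    ∃ C > 0, ∀ (g : SchwartzMap V ℂ) (M : ℝ), 0 < M →
      ∫⁻ ξ, ENNReal.ofReal ((‖ξ‖ ^ σ * ‖𝓕 g ξ‖) ^ 2) ≤ ENNReal.ofReal (M ^ 2) →
      ∫⁻ x, ENNReal.ofReal (‖g x‖ ^ q) ≤ ENNReal.ofReal (C * M ^ q) := by
  obtain ⟨k, hk, hweak⟩ := exists_meas_norm_gt_le (V := V) hβ hσβ
  have hq2 : 0 < q - 2 := by linarith
  refine ⟨q * (4 * (1 / (q - 2) * k ^ (q - 2))), by positivity, fun g M hM hg ↦ ?_⟩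
  have hmeas : Measurable ⇑(𝓕 g : SchwartzMap V ℂ) := (𝓕 g : SchwartzMap V ℂ).continuous.measurable
  set ν : Measure V := volume.withDensity fun ξ ↦ ‖𝓕 g ξ‖ₑ ^ 2 with hν
  have hL : Measurable fun ξ : V ↦ k * M * ‖ξ‖ ^ β := by fun_prop
  set X := ∫⁻ t in Set.Ioi (0 : ℝ), ν {ξ : V | t ≤ k * M * ‖ξ‖ ^ β} *
    ENNReal.ofReal (t ^ (q - 2 - 1)) with hX
  have hXle : X ≤ ENNReal.ofReal (1 / (q - 2) * k ^ (q - 2) * M ^ q) := by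
    have hlayer := lintegral_rpow_eq_lintegral_meas_le_mul ν (f := fun ξ : V ↦ k * M * ‖ξ‖ ^ β)
      (ae_of_all _ fun ξ ↦ by positivity) hL.aemeasurable hq2
    have hval : ∫⁻ ξ, ENNReal.ofReal ((k * M * ‖ξ‖ ^ β) ^ (q - 2)) ∂ν
        = ENNReal.ofReal ((k * M) ^ (q - 2))
          * ∫⁻ ξ, ENNReal.ofReal ((‖ξ‖ ^ σ * ‖𝓕 g ξ‖) ^ 2) := by
      rw [hν, lintegral_withDensity_eq_lintegral_mul _ (by fun_prop) (by fun_prop),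
        ← lintegral_const_mul _ (by fun_prop)]
      refine lintegral_congr fun ξ ↦ ?_
      rw [Pi.mul_apply, ← ofReal_norm, ← ENNReal.ofReal_pow (norm_nonneg _),
        ← ENNReal.ofReal_mul (by positivity), ← ENNReal.ofReal_mul (by positivity),
        Real.mul_rpow (by positivity) (by positivity), ← Real.rpow_mul (norm_nonneg _), hqβ,
        mul_comm 2 σ, Real.rpow_mul (norm_nonneg _), Real.rpow_two]
      ring_nf
    calc X = ENNReal.ofReal (1 / (q - 2)) * (ENNReal.ofReal (q - 2) * X) := by
          rw [← mul_assoc, ← ENNReal.ofReal_mul (by positivity), one_div_mul_cancel hq2.ne',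
            ENNReal.ofReal_one, one_mul]
      _ ≤ ENNReal.ofReal (1 / (q - 2)) *
          (ENNReal.ofReal ((k * M) ^ (q - 2)) * ENNReal.ofReal (M ^ 2)) := by
          rw [hX, ← hlayer, hval]
          gcongr
      _ = _ := by
          rw [← ENNReal.ofReal_mul (by positivity), ← ENNReal.ofReal_mul (by positivity),
            Real.mul_rpow hk.le hM.le, mul_assoc (k ^ _), ← Real.rpow_two, ← Real.rpow_add hM]
          ring_nf
  calc ∫⁻ x, ENNReal.ofReal (‖g x‖ ^ q)
      = ENNReal.ofReal q * ∫⁻ t in Set.Ioi (0 : ℝ),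
          volume {x | t < ‖g x‖} * ENNReal.ofReal (t ^ (q - 1)) :=
        lintegral_rpow_eq_lintegral_meas_lt_mul volume (ae_of_all _ fun x ↦ norm_nonneg _)
          g.continuous.norm.aemeasurable (by linarith)
    _ ≤ ENNReal.ofReal q * ∫⁻ t in Set.Ioi (0 : ℝ), ENNReal.ofReal 4 *
          (ν {ξ : V | t ≤ k * M * ‖ξ‖ ^ β} * ENNReal.ofReal (t ^ (q - 2 - 1))) := by
        gcongr ENNReal.ofReal q * ?_
        refine setLIntegral_mono' measurableSet_Ioi fun t (ht : 0 < t) ↦ ?_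
        rw [hν, withDensity_apply _ (measurableSet_le measurable_const hL)]
        refine (mul_le_mul_left (hweak g M t hM ht hg) _).trans_eq ?_
        rw [mul_right_comm, ← ENNReal.ofReal_mul (by positivity), mul_comm (lintegral _ _),
          ← mul_assoc, ← ENNReal.ofReal_mul (by positivity)]
        congr 2
        rw [show q - 1 = q - 2 - 1 + 2 by ring, Real.rpow_add ht (q - 2 - 1), Real.rpow_two]
        field_simp
    _ = ENNReal.ofReal q * (ENNReal.ofReal 4 * X) := by
        rw [lintegral_const_mul' _ _ ENNReal.ofReal_ne_top]
    _ ≤ ENNReal.ofReal q * (ENNReal.ofReal 4 *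
          ENNReal.ofReal (1 / (q - 2) * k ^ (q - 2) * M ^ q)) := by gcongr
    _ = _ := by
        rw [← ENNReal.ofReal_mul (by positivity), ← ENNReal.ofReal_mul (by positivity)]
        ring_nf

theorem integrable_norm_rpow_mul_sq (f : SchwartzMap V ℂ) {s : ℝ} (hs : 0 < s) :
    Integrable fun ξ ↦ (‖ξ‖ ^ s * ‖f ξ‖) ^ 2 := by
  obtain ⟨m, hm⟩ := exists_nat_ge (2 * s)
  obtain ⟨B, hB, hfB⟩ := f.decay 0 0
  have hmeas : Measurable f := f.continuous.measurable
  have hint : Integrable fun ξ ↦ B * (‖ξ‖ ^ 0 * ‖f ξ‖ + ‖ξ‖ ^ m * ‖f ξ‖) :=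
    ((f.integrable_pow_mul volume 0).add (f.integrable_pow_mul volume m)).const_mul B
  refine hint.mono' (by fun_prop) (ae_of_all _ fun ξ ↦ ?_)
  have h1 : (‖ξ‖ ^ s) ^ 2 ≤ 1 + ‖ξ‖ ^ m := by
    rw [← Real.rpow_two, ← Real.rpow_mul (norm_nonneg _), mul_comm s 2, ← Real.rpow_natCast]
    rcases le_total ‖ξ‖ 1 with h | h
    · have := Real.rpow_le_one (norm_nonneg ξ) h (by positivity : 0 ≤ 2 * s)
      have : 0 ≤ ‖ξ‖ ^ (m : ℝ) := by positivity
      linarith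
    · linarith [Real.rpow_le_rpow_of_exponent_le h hm]
  have h2 : ‖f ξ‖ ≤ B := by simpa using hfB ξ
  rw [Real.norm_of_nonneg (by positivity)]
  calc (‖ξ‖ ^ s * ‖f ξ‖) ^ 2 = (‖ξ‖ ^ s) ^ 2 * (‖f ξ‖ * ‖f ξ‖) := by ring
    _ ≤ (1 + ‖ξ‖ ^ m) * (B * ‖f ξ‖) := by gcongr
    _ = _ := by ring

/-- Interpolation between `L²` and a homogeneous Sobolev norm, on the Fourier side. -/
theorem lintegral_norm_rpow_mul_sq_le (f : SchwartzMap V ℂ) {s θ : ℝ} (hs : 0 < s) (hθ0 : 0 ≤ θ)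
    (hθ1 : θ ≤ 1) :
    ∫⁻ ξ, ENNReal.ofReal ((‖ξ‖ ^ (θ * s) * ‖f ξ‖) ^ 2) ≤
      ENNReal.ofReal ((∫ ξ, (‖ξ‖ ^ s * ‖f ξ‖) ^ 2) ^ θ * (∫ ξ, ‖f ξ‖ ^ 2) ^ (1 - θ)) := by
  have hmeas : Measurable f := f.continuous.measurable
  have hθ1' : 0 ≤ 1 - θ := by linarith
  have hint2 : Integrable fun ξ ↦ ‖f ξ‖ ^ 2 := (f.memLp 2).integrable_norm_pow (by norm_num)
  rw [ENNReal.ofReal_mul (by positivity), ← ENNReal.ofReal_rpow_of_nonneg (by positivity) hθ0,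
    ← ENNReal.ofReal_rpow_of_nonneg (by positivity) hθ1',
    ofReal_integral_eq_lintegral_ofReal (integrable_norm_rpow_mul_sq f hs)
      (ae_of_all _ fun x ↦ by positivity),
    ofReal_integral_eq_lintegral_ofReal hint2 (ae_of_all _ fun x ↦ by positivity)]
  refine le_trans (le_of_eq (lintegral_congr fun ξ ↦ ?_))
    (ENNReal.lintegral_mul_norm_pow_le (by fun_prop) (by fun_prop) hθ0 hθ1' (by ring))
  rw [ENNReal.ofReal_rpow_of_nonneg (by positivity) hθ0,
    ENNReal.ofReal_rpow_of_nonneg (by positivity) hθ1', ← ENNReal.ofReal_mul (by positivity)]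
  congr 1
  rw [mul_pow, mul_pow, Real.mul_rpow (by positivity) (by positivity), mul_assoc,
    ← Real.rpow_add_of_nonneg (by positivity) hθ0 hθ1', add_sub_cancel, Real.rpow_one,
    ← Real.rpow_mul_natCast (norm_nonneg _), ← Real.rpow_mul_natCast (norm_nonneg _),
    ← Real.rpow_mul (norm_nonneg _)]
  ring_nf

end

theorem fractional_gagliardo_nirenberg (n : ℕ) (hn : 1 ≤ n) (s q : ℝ) (hs : 0 < s)
    (hq : 2 ≤ q)
    (hθ0 : 0 ≤ ((n : ℝ) / s) * (1/2 - 1/q)) (hθ1 : ((n : ℝ) / s) * (1/2 - 1/q) ≤ 1) :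
    ∃ C > 0, ∀ g : SchwartzMap (EuclideanSpace ℝ (Fin n)) ℂ,
      (∫ x, ‖g x‖ ^ q) ^ (1/q)
        ≤ C * ((∫ ξ, (‖ξ‖ ^ s * ‖𝓕 (⇑g) ξ‖) ^ 2) ^ ((1:ℝ)/2)) ^ (((n : ℝ) / s) * (1/2 - 1/q))
            * ((∫ x, ‖g x‖ ^ 2) ^ ((1:ℝ)/2)) ^ (1 - ((n : ℝ) / s) * (1/2 - 1/q)) := by
  rcases hq.eq_or_lt with rfl | hq2
  · exact ⟨1, one_pos, fun g ↦ by simp⟩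
  have hn0 : (0 : ℝ) < n := by exact_mod_cast hn
  have : Nontrivial (EuclideanSpace ℝ (Fin n)) :=
    Module.nontrivial_of_finrank_pos (R := ℝ) (by rw [finrank_euclideanSpace_fin]; lia)
  have hq0 : 0 < q := by linarith
  set θ := ((n : ℝ) / s) * (1/2 - 1/q) with hθ
  obtain ⟨C, hC, hsob⟩ := exists_lintegral_norm_rpow_le (V := EuclideanSpace ℝ (Fin n))
    (σ := θ * s) (β := n / q) (q := q) (by positivity) hq2
    (by rw [finrank_euclideanSpace_fin, hθ]; field_simp; ring) (by rw [hθ]; field_simp)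
  refine ⟨C ^ (1 / q), by positivity, fun g ↦ ?_⟩
  set I := ∫ ξ, (‖ξ‖ ^ s * ‖𝓕 (⇑g) ξ‖) ^ 2 with hI
  set J := ∫ x, ‖g x‖ ^ 2 with hJ
  have hI0 : 0 ≤ I := by positivity
  have hJ0 : 0 ≤ J := by positivity
  have hinterp := lintegral_norm_rpow_mul_sq_le (𝓕 g) hs hθ0 hθ1
  rw [SchwartzMap.integral_norm_sq_fourier, SchwartzMap.fourier_coe, ← hI, ← hJ] at hinterp
  set N := (I ^ ((1:ℝ)/2)) ^ θ * (J ^ ((1:ℝ)/2)) ^ (1 - θ) with hN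
  have hN0 : 0 ≤ N := by positivity
  have hNsq : I ^ θ * J ^ (1 - θ) = N ^ 2 := by
    rw [hN, mul_pow, ← Real.rpow_mul hI0, ← Real.rpow_mul hJ0, ← Real.rpow_two, ← Real.rpow_two,
      ← Real.rpow_mul hI0, ← Real.rpow_mul hJ0]
    ring_nf
  rw [hNsq] at hinterp
  rw [mul_assoc, ← hN, ← div_le_iff₀' (by positivity)]
  refine le_of_forall_gt_imp_ge_of_dense fun M hM ↦ ?_
  have hM0 : 0 < M := hN0.trans_lt hM
  have hle := hsob g M hM0 (hinterp.trans (by gcongr))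
  have hle' : ∫ x, ‖g x‖ ^ q ≤ C * M ^ q := by
    rw [integral_eq_lintegral_of_nonneg_ae (ae_of_all _ fun x ↦ by positivity)
      (g.continuous.measurable.norm.pow_const q).aestronglyMeasurable]
    exact ENNReal.toReal_le_of_le_ofReal (by positivity) hle
  rw [div_le_iff₀' (by positivity)]
  calc (∫ x, ‖g x‖ ^ q) ^ (1 / q) ≤ (C * M ^ q) ^ (1 / q) := by gcongr
    _ = C ^ (1 / q) * M := by
      rw [Real.mul_rpow hC.le (by positivity), ← Real.rpow_mul hM0.le, mul_one_div_cancel hq0.ne',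
        Real.rpow_one]
end
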